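/- Let X be a normed vector space over ℝ or ℂ and T : X → X a bounded linear operator with the positive shadowing property. Then the non-wandering set Ω of T equals the chain recurrent set CR(T), and consequently Ω is a closed T-invariant linear subspace of X. -/

import Mathlib

/-- An `ε`-chain of `T` from `x` to `y`: a finite sequence `x = c 0, c 1, …, c n = y`
with `n ≥ 1` such that `‖T (c i) - c (i+1)‖ < ε` for every `0 ≤ i < n`. -/
def EpsChain {E : Type*} [NormedAddCommGroup E] (T : E → E) (ε : ℝ) (x y : E) : Prop :=
  ∃ (n : ℕ) (c : ℕ → E), 1 ≤ n ∧ c 0 = x ∧ c n = y ∧ ∀ i < n, ‖T (c i) - c (i + 1)‖ < ε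

/-- `x` is a chain recurrent point of `T` if for every `ε > 0` there is an `ε`-chain
beginning and ending at `x`. -/
def ChainRecurrent {E : Type*} [NormedAddCommGroup E] (T : E → E) (x : E) : Prop :=
  ∀ ε > 0, EpsChain T ε x x

/-- `T` has the positive shadowing property: for every `ε > 0` there is `δ > 0` such
that every positive `δ`-pseudo orbit `(x n)` (i.e. `‖T (x n) - x (n+1)‖ ≤ δ` for all `n`)
is `ε`-shadowed by some `z`, i.e. `‖x n - T^[n] z‖ < ε` for all `n`. -/
def PosShadowing {E : Type*} [NormedAddCommGroup E] (T : E → E) : Prop :=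
  ∀ ε > 0, ∃ δ > 0, ∀ x : ℕ → E, (∀ n : ℕ, ‖T (x n) - x (n + 1)‖ ≤ δ) →
    ∃ z : E, ∀ n : ℕ, ‖x n - T^[n] z‖ < ε

/-- `x` is a non-wandering point of `T`: for every open set `B` containing `x` and every
`N ∈ ℕ` there is `n > N` with `T^n(B) ∩ B ≠ ∅`. -/
def NonWandering {E : Type*} [NormedAddCommGroup E] (T : E → E) (x : E) : Prop :=
  ∀ B : Set E, IsOpen B → x ∈ B → ∀ N : ℕ, ∃ n > N, (T^[n] '' B ∩ B).Nonempty

/-- An `ε`-chain from `x` to `x` extends to a periodic sequence of `ε`-steps. -/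
theorem EpsChain.exists_periodic {E : Type*} [NormedAddCommGroup E] {T : E → E} {ε : ℝ} {x : E}
    (h : EpsChain T ε x x) :
    ∃ (n : ℕ) (c : ℕ → E), 1 ≤ n ∧ c 0 = x ∧ Function.Periodic c n ∧
      ∀ i, ‖T (c i) - c (i + 1)‖ < ε := by
  obtain ⟨n, c, hn, h0, hcn, hc⟩ := h
  refine ⟨n, fun i ↦ c (i % n), hn, by simpa using h0, fun i ↦ by simp, fun i ↦ ?_⟩
  have hlt : i % n < n := Nat.mod_lt _ hn
  have key : c ((i + 1) % n) = c (i % n + 1) := by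
    rcases Nat.lt_or_ge (i % n + 1) n with h | h
    · rw [← Nat.mod_add_mod, Nat.mod_eq_of_lt h]
    · have he : i % n + 1 = n := by omega
      rw [← Nat.mod_add_mod, he, Nat.mod_self, h0, hcn]
  simpa only [key] using hc _ hlt

/-- Non-wandering points of a continuous map are chain recurrent. -/
theorem NonWandering.chainRecurrent {E : Type*} [NormedAddCommGroup E] {T : E → E} {x : E}
    (hT : Continuous T) (h : NonWandering T x) : ChainRecurrent T x := by
  intro ε hε
  obtain ⟨n, hn, _, ⟨y, hy, rfl⟩, hyn⟩ :=
    h (Metric.ball x ε ∩ T ⁻¹' Metric.ball (T x) ε)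
      (Metric.isOpen_ball.inter (Metric.isOpen_ball.preimage hT))
      ⟨Metric.mem_ball_self hε, Metric.mem_ball_self hε⟩ 1
  refine ⟨n, fun i ↦ if i = 0 ∨ i = n then x else T^[i] y, by omega, by simp, by simp,
    fun i hi ↦ ?_⟩
  rcases Nat.eq_zero_or_pos i with rfl | hpos
  · have h1 : 1 ≠ n := by omega
    simpa [h1, dist_eq_norm, norm_sub_rev] using hy.2
  · have h1 : ¬ (i = 0 ∨ i = n) := by omega
    simp only [h1, if_false, ← Function.iterate_succ_apply' T]
    by_cases h2 : i + 1 = n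
    · simpa [h2, dist_eq_norm] using hyn.1
    · simpa [h2] using hε

/-- Under positive shadowing, chain recurrent points are non-wandering. -/
theorem ChainRecurrent.nonWandering {E : Type*} [NormedAddCommGroup E] {T : E → E} {x : E}
    (hsh : PosShadowing T) (h : ChainRecurrent T x) : NonWandering T x := by
  intro B hB hx N
  obtain ⟨ε, hε, hεB⟩ := Metric.isOpen_iff.1 hB x hx
  obtain ⟨δ, hδ, hsh⟩ := hsh ε hε
  obtain ⟨n, c, hn, h0, hper, hc⟩ := (h δ hδ).exists_periodic
  obtain ⟨z, hz⟩ := hsh c fun i ↦ (hc i).le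
  have hmem : ∀ k : ℕ, T^[k * n] z ∈ B := fun k ↦ hεB <| by
    have hk : c (k * n) = x := by rw [← h0]; simpa using hper.nat_mul k 0
    simpa [hk, dist_eq_norm, norm_sub_rev] using hz (k * n)
  exact ⟨(N + 1) * n, by nlinarith, _, ⟨z, by simpa using hmem 0, rfl⟩, hmem (N + 1)⟩

/-- Non-wandering points are mapped to non-wandering points by a continuous map. -/
theorem NonWandering.map {E : Type*} [NormedAddCommGroup E] {T : E → E} {x : E}
    (hT : Continuous T) (h : NonWandering T x) : NonWandering T (T x) := by
  intro B hB hx N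
  obtain ⟨n, hn, _, ⟨y, hy, rfl⟩, hyn⟩ := h (T ⁻¹' B) (hB.preimage hT) hx N
  refine ⟨n, hn, T^[n] (T y), ⟨T y, hy, rfl⟩, ?_⟩
  rwa [← Function.iterate_succ_apply, Function.iterate_succ_apply']

/-- The non-wandering set is closed. -/
theorem isClosed_setOf_nonWandering {E : Type*} [NormedAddCommGroup E] (T : E → E) :
    IsClosed {x | NonWandering T x} := by
  refine isClosed_of_closure_subset fun x hx B hB hxB N ↦ ?_
  obtain ⟨y, hyB, hy⟩ := mem_closure_iff.1 hx B hB hxB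
  exact hy B hB hyB N

theorem ChainRecurrent.add {𝕜 X : Type*} [RCLike 𝕜] [NormedAddCommGroup X] [NormedSpace 𝕜 X]
    {T : X →L[𝕜] X} {x y : X} (hx : ChainRecurrent T x) (hy : ChainRecurrent T y) :
    ChainRecurrent T (x + y) := by
  intro ε hε
  obtain ⟨n, c, hn, hc0, hcper, hc⟩ := (hx (ε / 2) (half_pos hε)).exists_periodic
  obtain ⟨m, d, hm, hd0, hdper, hd⟩ := (hy (ε / 2) (half_pos hε)).exists_periodic
  have hcnm : c (n * m) = x := by rw [← hc0, mul_comm]; simpa using hcper.nat_mul m 0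
  have hdnm : d (n * m) = y := by rw [← hd0]; simpa using hdper.nat_mul n 0
  refine ⟨n * m, fun i ↦ c i + d i, Nat.mul_pos hn hm, by simp [hc0, hd0], by simp [hcnm, hdnm],
    fun i _ ↦ ?_⟩
  calc ‖T (c i + d i) - (c (i + 1) + d (i + 1))‖
      = ‖(T (c i) - c (i + 1)) + (T (d i) - d (i + 1))‖ := by rw [map_add]; congr 1; abel
    _ ≤ ‖T (c i) - c (i + 1)‖ + ‖T (d i) - d (i + 1)‖ := norm_add_le _ _
    _ < ε := by linarith [hc i, hd i]

theorem ChainRecurrent.smul {𝕜 X : Type*} [RCLike 𝕜] [NormedAddCommGroup X] [NormedSpace 𝕜 X]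
    {T : X →L[𝕜] X} {x : X} (a : 𝕜) (hx : ChainRecurrent T x) : ChainRecurrent T (a • x) := by
  intro ε hε
  have ha : 0 < ‖a‖ + 1 := by positivity
  obtain ⟨n, c, hn, hc0, hcn, hc⟩ := hx (ε / (‖a‖ + 1)) (div_pos hε ha)
  refine ⟨n, fun i ↦ a • c i, hn, by simp [hc0], by simp [hcn], fun i hi ↦ ?_⟩
  have h := (lt_div_iff₀ ha).1 (hc i hi)
  rw [map_smul, ← smul_sub, norm_smul]
  nlinarith [norm_nonneg (T (c i) - c (i + 1))]

/-- The chain recurrent points of a bounded linear operator form a linear subspace. -/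
def chainRecurrentSubmodule {𝕜 X : Type*} [RCLike 𝕜] [NormedAddCommGroup X] [NormedSpace 𝕜 X]
    (T : X →L[𝕜] X) : Submodule 𝕜 X where
  carrier := {x | ChainRecurrent T x}
  add_mem' := ChainRecurrent.add
  zero_mem' := fun _ hε ↦ ⟨1, fun _ ↦ 0, le_rfl, rfl, rfl, fun _ _ ↦ by simpa using hε⟩
  smul_mem' := fun a _ ↦ ChainRecurrent.smul a

/-- If a bounded linear operator `T` on a normed space has the positive shadowing
property, then its non-wandering set `Ω` equals the chain recurrent set `CR(T)`, and
consequently `Ω` is a closed `T`-invariant linear subspace of `X`. -/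
theorem stmt_17 {𝕜 : Type*} [RCLike 𝕜] {X : Type*} [NormedAddCommGroup X]
    [NormedSpace 𝕜 X] (T : X →L[𝕜] X) (hsh : PosShadowing (⇑T)) :
    {x | NonWandering (⇑T) x} = {x | ChainRecurrent (⇑T) x} ∧
    (∃ S : Submodule 𝕜 X, (S : Set X) = {x | NonWandering (⇑T) x}) ∧
    IsClosed {x | NonWandering (⇑T) x} ∧
    (∀ x : X, NonWandering (⇑T) x → NonWandering (⇑T) (T x)) := by
  have heq : {x | NonWandering (⇑T) x} = {x | ChainRecurrent (⇑T) x} :=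
    Set.ext fun _ ↦ ⟨NonWandering.chainRecurrent T.continuous, ChainRecurrent.nonWandering hsh⟩
  exact ⟨heq, ⟨chainRecurrentSubmodule T, heq.symm⟩, isClosed_setOf_nonWandering T,
    fun _ ↦ NonWandering.map T.continuous⟩
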